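/- Let λ > 1 be irrational, let I ⊆ (0,1) be an open interval whose closure is contained in (0,1), and let f ∈ G_λ, f ≠ id, satisfy Supp(f) ⊆ ⋃_{n ∈ ℤ} (n + I). Then there exist an element h ≠ id of the normal closure of f in G_λ and N ∈ ℕ such that h is (I,N)-stable, meaning: (1) Supp(h) ⊆ ⋃_{n ∈ ℤ} (n + I); and (2) there exists g ∈ F, g ≠ id, such that every interval K ⊆ ℝ of length greater than N contains an interval [m, m+1] with m ∈ ℤ on which h agrees with ν(g), i.e. x·h = x·ν(g) for all x ∈ [m, m+1]. -/

import Mathlib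

open Set

noncomputable section

/-- The dyadic rationals `ℤ[1/2]` inside `ℝ`. -/
def DyadicRat : Set ℝ := {x : ℝ | ∃ (a : ℤ) (k : ℕ), x = a / 2 ^ k}

/-- A function `g : ℝ → ℝ` satisfies the defining conditions of (the underlying map of)
an element of `T̄`: it commutes with the translation `x ↦ x + 1`, and away from a
locally finite set `D ⊆ ℤ[1/2]` of allowed breakpoints it is locally affine with slope
an integer power of `2`.  (Local finiteness of `D` on compact intervals encodes
"finitely many breakpoints in each compact interval".) -/
def TbarFun (g : ℝ → ℝ) : Prop :=
  (∀ x : ℝ, g (x + 1) = g x + 1) ∧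
  ∃ D : Set ℝ, D ⊆ DyadicRat ∧ (∀ a b : ℝ, (D ∩ Set.Icc a b).Finite) ∧
    ∀ x : ℝ, x ∉ D → ∃ (m : ℤ) (c ε : ℝ), 0 < ε ∧
      ∀ y : ℝ, |y - x| < ε → g y = 2 ^ m * y + c

/-- The lift `T̄` of Thompson's group `T` to the real line, as a set of increasing
bijections of `ℝ`. -/
def Tbar : Set (Equiv.Perm ℝ) := {g : Equiv.Perm ℝ | StrictMono ⇑g ∧ TbarFun ⇑g}

/-- `T̄_λ = m_λ⁻¹ T̄ m_λ`, where `x · m_λ = λ x`: the lift of `T` with respect to the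
identification `ℝ → ℝ/λℤ`. -/
def TbarL (l : ℝ) : Set (Equiv.Perm ℝ) :=
  {g : Equiv.Perm ℝ | StrictMono ⇑g ∧ TbarFun (fun y : ℝ => g (l * y) / l)}

/-- The group `G_λ = ⟨T̄ ∪ T̄_λ⟩ ≤ Homeo⁺(ℝ)`. -/
def Glambda (l : ℝ) : Subgroup (Equiv.Perm ℝ) := Subgroup.closure (Tbar ∪ TbarL l)

/-- The pointwise stabilizer `F₁` of `ℤ` in `T̄`, i.e. the image of the natural
embedding `ν : F → T̄` of Thompson's group `F`. -/
def Fone : Set (Equiv.Perm ℝ) := {g : Equiv.Perm ℝ | g ∈ Tbar ∧ ∀ m : ℤ, g (m : ℝ) = (m : ℝ)}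

open scoped commutatorElement

/-! ### Dyadic rationals -/

/-- The dyadic rationals as a subring of `ℝ`. -/
def dyadicSubring : Subring ℝ where
  carrier := DyadicRat
  zero_mem' := ⟨0, 0, by simp⟩
  one_mem' := ⟨1, 0, by simp⟩
  add_mem' := by
    rintro _ _ ⟨a, k, rfl⟩ ⟨b, j, rfl⟩
    exact ⟨a * 2 ^ j + b * 2 ^ k, k + j, by push_cast; field_simp; ring⟩
  mul_mem' := by
    rintro _ _ ⟨a, k, rfl⟩ ⟨b, j, rfl⟩
    exact ⟨a * b, k + j, by push_cast; field_simp; ring⟩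
  neg_mem' := by
    rintro _ ⟨a, k, rfl⟩
    exact ⟨-a, k, by push_cast; ring⟩

lemma inv_two_pow_mem_dyadicSubring (k : ℕ) : ((2 : ℝ) ^ k)⁻¹ ∈ dyadicSubring :=
  ⟨1, k, by simp⟩

lemma two_zpow_mem_dyadicSubring (m : ℤ) : (2 : ℝ) ^ m ∈ dyadicSubring := by
  have h2 : (2 : ℝ) ∈ dyadicSubring := by exact_mod_cast intCast_mem dyadicSubring 2
  obtain ⟨k, rfl | rfl⟩ := m.eq_nat_or_neg
  · rw [zpow_natCast]
    exact pow_mem h2 k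
  · rw [zpow_neg, zpow_natCast]
    exact inv_two_pow_mem_dyadicSubring k

lemma div_two_pow_mem_dyadicSubring {x : ℝ} (hx : x ∈ dyadicSubring) (k : ℕ) :
    x / 2 ^ k ∈ dyadicSubring := by
  rw [div_eq_mul_inv]
  exact mul_mem hx (inv_two_pow_mem_dyadicSubring k)

/-! ### Increasing permutations of the line -/

lemma Equiv.Perm.apply_inv_apply {α : Type*} (g : Equiv.Perm α) (x : α) : g (g⁻¹ x) = x :=
  g.apply_symm_apply x

lemma Equiv.Perm.inv_apply_apply {α : Type*} (g : Equiv.Perm α) (x : α) : g⁻¹ (g x) = x :=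
  g.symm_apply_apply x

lemma Equiv.Perm.strictMono_inv {g : Equiv.Perm ℝ} (hg : StrictMono g) :
    StrictMono (g⁻¹ : Equiv.Perm ℝ) := fun x y hxy => by
  rw [← hg.lt_iff_lt]
  simpa using hxy

lemma Equiv.Perm.continuous_of_strictMono {g : Equiv.Perm ℝ} (hg : StrictMono g) :
    Continuous g :=
  hg.monotone.continuous_of_surjective g.surjective

/-- Increasing permutations of `ℝ` commuting with a translation are uniformly continuous. -/
lemma Equiv.Perm.uniformContinuous_of_translation {g : Equiv.Perm ℝ} (hg : StrictMono g)
    {L : ℝ} (hL : 0 < L) (ht : ∀ x (n : ℤ), g (x + n * L) = g x + n * L) :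
    UniformContinuous g := by
  have h := isCompact_Icc.uniformContinuousOn_of_continuous
    ((Equiv.Perm.continuous_of_strictMono hg).continuousOn (s := Icc 0 (2 * L)))
  rw [Metric.uniformContinuousOn_iff] at h
  rw [Metric.uniformContinuous_iff]
  intro ε hε
  obtain ⟨δ, hδ, h⟩ := h ε hε
  have key : ∀ x y : ℝ, x ≤ y → y - x < min δ L → dist (g x) (g y) < ε := by
    intro x y hxy hd
    obtain ⟨hd1, hd2⟩ := lt_min_iff.1 hd
    have h1 : (⌊x / L⌋ : ℝ) * L ≤ x := by
      rw [← le_div_iff₀ hL]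
      exact Int.floor_le _
    have h2 : x < (⌊x / L⌋ + 1 : ℝ) * L := by
      rw [← div_lt_iff₀ hL]
      exact Int.lt_floor_add_one _
    set n := ⌊x / L⌋
    have h3 := h (x - n * L) ⟨by linarith, by linarith⟩ (y - n * L) ⟨by linarith, by linarith⟩
      (by rw [dist_sub_right, dist_comm, Real.dist_eq, abs_of_nonneg (by linarith)]; exact hd1)
    have e1 := ht (x - n * L) n
    have e2 := ht (y - n * L) n
    rw [sub_add_cancel] at e1 e2
    rwa [e1, e2, dist_add_right]
  refine ⟨min δ L, lt_min hδ hL, fun {x y} hd => ?_⟩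
  rcases le_total x y with hxy | hxy
  · refine key x y hxy ?_
    rwa [dist_comm, Real.dist_eq, abs_of_nonneg (by linarith)] at hd
  · rw [dist_comm]
    refine key y x hxy ?_
    rwa [Real.dist_eq, abs_of_nonneg (by linarith)] at hd

lemma map_add_int_mul_of_map_add {g : ℝ → ℝ} {L : ℝ} (h : ∀ x, g (x + L) = g x + L)
    (x : ℝ) (n : ℤ) : g (x + n * L) = g x + n * L := by
  have hp : Function.Periodic (fun x => g x - x) L := fun x => by simp [h]
  have := hp.int_mul n x
  linarith

lemma Equiv.Perm.inv_map_add {g : Equiv.Perm ℝ} {L : ℝ} (h : ∀ x, g (x + L) = g x + L)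
    (x : ℝ) : g⁻¹ (x + L) = g⁻¹ x + L := by
  rw [Equiv.Perm.inv_eq_iff_eq, h, Equiv.Perm.apply_inv_apply]

/-! ### Almost periodicity of elements of `G_λ` -/

/-- `g` is an increasing bi-uniformly continuous permutation almost commuting with those integer
translations that are close to a multiple of `l`. -/
structure AlmostCommutes (l : ℝ) (g : Equiv.Perm ℝ) : Prop where
  strictMono : StrictMono g
  uniformContinuous : UniformContinuous g
  uniformContinuous_inv : UniformContinuous (g⁻¹ : Equiv.Perm ℝ)
  almost_translation : ∀ ε > 0, ∃ δ > 0, ∀ m k : ℤ, |(m : ℝ) - k * l| < δ →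
    ∀ x, |g (x + m) - (g x + m)| < ε

lemma AlmostCommutes.one (l : ℝ) : AlmostCommutes l 1 where
  strictMono := strictMono_id
  uniformContinuous := uniformContinuous_id
  uniformContinuous_inv := uniformContinuous_id
  almost_translation ε hε := ⟨1, one_pos, fun m k _ x => by simpa using hε⟩

lemma AlmostCommutes.mul {l : ℝ} {f g : Equiv.Perm ℝ} (hf : AlmostCommutes l f)
    (hg : AlmostCommutes l g) : AlmostCommutes l (f * g) where
  strictMono := hf.strictMono.comp hg.strictMono
  uniformContinuous := hf.uniformContinuous.comp hg.uniformContinuous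
  uniformContinuous_inv := by
    rw [mul_inv_rev]
    exact hg.uniformContinuous_inv.comp hf.uniformContinuous_inv
  almost_translation ε hε := by
    obtain ⟨η, hη, hfη⟩ := Metric.uniformContinuous_iff.1 hf.uniformContinuous (ε / 2) (half_pos hε)
    obtain ⟨δ₁, hδ₁, h1⟩ := hg.almost_translation η hη
    obtain ⟨δ₂, hδ₂, h2⟩ := hf.almost_translation (ε / 2) (half_pos hε)
    refine ⟨min δ₁ δ₂, lt_min hδ₁ hδ₂, fun m k hmk x => ?_⟩
    obtain ⟨hm1, hm2⟩ := lt_min_iff.1 hmk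
    have e1 := hfη (a := g (x + m)) (b := g x + m) (h1 m k hm1 x)
    have e2 := h2 m k hm2 (g x)
    rw [Real.dist_eq] at e1
    simp only [Equiv.Perm.mul_apply]
    rw [abs_lt] at *
    constructor <;> linarith

lemma AlmostCommutes.inv {l : ℝ} {f : Equiv.Perm ℝ} (hf : AlmostCommutes l f) :
    AlmostCommutes l f⁻¹ where
  strictMono := Equiv.Perm.strictMono_inv hf.strictMono
  uniformContinuous := hf.uniformContinuous_inv
  uniformContinuous_inv := by simpa using hf.uniformContinuous
  almost_translation ε hε := by
    obtain ⟨η, hη, hfη⟩ := Metric.uniformContinuous_iff.1 hf.uniformContinuous_inv ε hε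
    obtain ⟨δ, hδ, h⟩ := hf.almost_translation η hη
    refine ⟨δ, hδ, fun m k hmk x => ?_⟩
    have e1 := h m k hmk (f⁻¹ x)
    rw [Equiv.Perm.apply_inv_apply, abs_sub_comm] at e1
    simpa [Real.dist_eq] using hfη (a := x + m) (b := f (f⁻¹ x + m)) e1

lemma AlmostCommutes.of_mem_Tbar {l : ℝ} {g : Equiv.Perm ℝ} (hg : g ∈ Tbar) :
    AlmostCommutes l g where
  strictMono := hg.1
  uniformContinuous := Equiv.Perm.uniformContinuous_of_translation hg.1 one_pos
    (map_add_int_mul_of_map_add hg.2.1)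
  uniformContinuous_inv := Equiv.Perm.uniformContinuous_of_translation
    (Equiv.Perm.strictMono_inv hg.1) one_pos
    (map_add_int_mul_of_map_add (Equiv.Perm.inv_map_add hg.2.1))
  almost_translation ε hε := ⟨1, one_pos, fun m k _ x => by
    have := map_add_int_mul_of_map_add hg.2.1 x m
    rw [mul_one] at this
    simpa [this] using hε⟩

lemma AlmostCommutes.of_mem_TbarL {l : ℝ} (hl : 0 < l) {g : Equiv.Perm ℝ} (hg : g ∈ TbarL l) :
    AlmostCommutes l g := by
  have ht : ∀ x, g (x + l) = g x + l := fun x => by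
    have := hg.2.1 (x / l)
    simp only at this
    rw [mul_add, mul_div_cancel₀ x hl.ne', mul_one] at this
    field_simp at this
    exact this
  have huc := Equiv.Perm.uniformContinuous_of_translation hg.1 hl (map_add_int_mul_of_map_add ht)
  refine ⟨hg.1, huc, Equiv.Perm.uniformContinuous_of_translation
    (Equiv.Perm.strictMono_inv hg.1) hl
    (map_add_int_mul_of_map_add (Equiv.Perm.inv_map_add ht)), fun ε hε => ?_⟩
  obtain ⟨η, hη, hgη⟩ := Metric.uniformContinuous_iff.1 huc (ε / 2) (half_pos hε)
  refine ⟨min η (ε / 2), lt_min hη (half_pos hε), fun m k hmk x => ?_⟩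
  obtain ⟨hm1, hm2⟩ := lt_min_iff.1 hmk
  have e1 := hgη (a := x + (m - k * l)) (b := x) (by simpa [Real.dist_eq] using hm1)
  have e2 := map_add_int_mul_of_map_add ht (x + (m - k * l)) k
  rw [show x + (m - k * l) + k * l = x + m by ring] at e2
  rw [Real.dist_eq] at e1
  rw [e2]
  rw [abs_lt] at *
  constructor <;> linarith

lemma AlmostCommutes.of_mem_Glambda {l : ℝ} (hl : 0 < l) {g : Equiv.Perm ℝ}
    (hg : g ∈ Glambda l) : AlmostCommutes l g := by
  induction hg using Subgroup.closure_induction with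
  | mem x hx => exact hx.elim .of_mem_Tbar (.of_mem_TbarL hl)
  | one => exact .one l
  | mul x y _ _ hx hy => exact hx.mul hy
  | inv x _ hx => exact hx.inv

/-- The integers close to a multiple of `l` are relatively dense. -/
lemma exists_int_near_multiple {l : ℝ} (hl : 0 < l) {δ : ℝ} (hδ : 0 < δ) :
    ∃ B : ℕ, ∀ p : ℤ, ∃ m k : ℤ, |p - m| ≤ B ∧ |(m : ℝ) - k * l| < δ := by
  obtain ⟨M, hM⟩ := exists_nat_gt (l / δ)
  have hM0 : (0 : ℝ) < M := (div_pos hl hδ).trans hM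
  let c : ℤ → ℤ := fun p => ⌊(M : ℝ) * Int.fract ((p : ℝ) / l)⌋
  have hfin : (Set.range c).Finite := by
    refine (Set.finite_Icc (0 : ℤ) M).subset ?_
    rintro _ ⟨p, rfl⟩
    refine ⟨Int.floor_nonneg.2 (mul_nonneg hM0.le (Int.fract_nonneg _)), ?_⟩
    have : ((c p : ℤ) : ℝ) ≤ M := (Int.floor_le _).trans
      (mul_le_of_le_one_right hM0.le (Int.fract_lt_one _).le)
    exact_mod_cast this
  have : Finite (Set.range c) := hfin
  obtain ⟨B, hB⟩ := (Set.finite_range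
    fun z : Set.range c => (Set.rangeSplitting c z).natAbs).bddAbove
  refine ⟨B, fun p => ?_⟩
  set r := Set.rangeSplitting c ⟨c p, p, rfl⟩ with hr
  have hcr : c r = c p := Set.apply_rangeSplitting c ⟨c p, p, rfl⟩
  refine ⟨p - r, ⌊(p : ℝ) / l⌋ - ⌊(r : ℝ) / l⌋, ?_, ?_⟩
  · have := hB ⟨⟨c p, p, rfl⟩, rfl⟩
    simp only [← hr] at this
    rw [sub_sub_cancel]
    exact (Int.abs_eq_natAbs r).trans_le (by exact_mod_cast this)
  · have h1 := Int.abs_sub_lt_one_of_floor_eq_floor hcr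
    rw [← mul_sub, abs_mul, abs_of_pos hM0, ← lt_div_iff₀' hM0] at h1
    have h2 : ((p - r : ℤ) : ℝ) - ((⌊(p : ℝ) / l⌋ - ⌊(r : ℝ) / l⌋ : ℤ) : ℝ) * l =
        l * -(Int.fract ((r : ℝ) / l) - Int.fract ((p : ℝ) / l)) := by
      simp only [Int.fract]
      push_cast
      field_simp
      ring
    rw [h2, abs_mul, abs_neg, abs_of_pos hl]
    calc l * _ < l * (1 / M) := by gcongr
      _ < δ := by
        rw [div_lt_iff₀ hδ] at hM
        rw [mul_one_div, div_lt_iff₀ hM0]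
        linarith

/-! ### Thompson's group inside the group of permutations -/

/-- A subgroup contained in `F₁`. Preservation of `DyadicRat` follows from the other conditions,
but including it makes closure under composition and inversion immediate. -/
def dyadicFone : Subgroup (Equiv.Perm ℝ) where
  carrier := {g | (StrictMono g ∧ TbarFun g) ∧ (∀ m : ℤ, g m = m) ∧
    ∀ x, g x ∈ DyadicRat ↔ x ∈ DyadicRat}
  one_mem' := by
    refine ⟨⟨strictMono_id, fun x => rfl, ∅, empty_subset _, fun a b => by simp, fun x _ =>
      ⟨0, 0, 1, one_pos, fun y _ => by simp⟩⟩, fun m => rfl, fun x => Iff.rfl⟩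
  mul_mem' := by
    rintro f g ⟨⟨hfm, hft, D, hD, hDf, hDl⟩, hfi, hfd⟩ ⟨⟨hgm, hgt, E, hE, hEf, hEl⟩, hgi, hgd⟩
    refine ⟨⟨hfm.comp hgm, fun x => ?_, E ∪ g ⁻¹' D, ?_, fun a b => ?_, fun x hx => ?_⟩,
      fun m => ?_, fun x => ?_⟩
    · simp [hft, hgt]
    · refine union_subset hE fun x hx => ?_
      exact (hgd x).1 (hD hx)
    · rw [union_inter_distrib_right]
      refine (hEf a b).union ?_
      refine ((hDf (g a) (g b)).preimage g.injective.injOn).subset ?_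
      rintro x ⟨hx, hxa, hxb⟩
      exact ⟨hx, hgm.monotone hxa, hgm.monotone hxb⟩
    · simp only [mem_union, mem_preimage, not_or] at hx
      obtain ⟨m, c, ε, hε, h1⟩ := hEl x hx.1
      obtain ⟨n, d, η, hη, h2⟩ := hDl (g x) hx.2
      obtain ⟨θ, hθ, h3⟩ := Metric.continuous_iff.1
        (Equiv.Perm.continuous_of_strictMono hgm) x η hη
      refine ⟨n + m, 2 ^ n * c + d, min ε θ, lt_min hε hθ, fun y hy => ?_⟩
      obtain ⟨hy1, hy2⟩ := lt_min_iff.1 hy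
      rw [Equiv.Perm.mul_apply, h2 (g y) (h3 y hy2), h1 y hy1, zpow_add₀ two_ne_zero]
      ring
    · simp [hgi, hfi]
    · simp [hgd, hfd]
  inv_mem' := by
    rintro g ⟨⟨hgm, hgt, E, hE, hEf, hEl⟩, hgi, hgd⟩
    have hgm' := Equiv.Perm.strictMono_inv hgm
    refine ⟨⟨hgm', Equiv.Perm.inv_map_add hgt, (g⁻¹ : Equiv.Perm ℝ) ⁻¹' E, fun x hx => ?_,
      fun a b => ?_, fun x hx => ?_⟩, fun m => ?_, fun x => ?_⟩
    · simpa using (hgd _).2 (hE hx)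
    · refine ((hEf (g⁻¹ a) (g⁻¹ b)).preimage (g⁻¹ : Equiv.Perm ℝ).injective.injOn).subset ?_
      rintro x ⟨hx, hxa, hxb⟩
      exact ⟨hx, hgm'.monotone hxa, hgm'.monotone hxb⟩
    · obtain ⟨m, c, ε, hε, h1⟩ := hEl _ hx
      obtain ⟨θ, hθ, h3⟩ := Metric.continuous_iff.1
        (Equiv.Perm.continuous_of_strictMono hgm') x ε hε
      refine ⟨-m, -(2 ^ (-m) * c), θ, hθ, fun y hy => ?_⟩
      have := h1 _ (h3 y hy)
      rw [Equiv.Perm.apply_inv_apply] at this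
      rw [zpow_neg]
      field_simp
      linarith
    · rw [Equiv.Perm.inv_eq_iff_eq, hgi]
    · rw [← hgd, Equiv.Perm.apply_inv_apply]

lemma dyadicFone_subset_Fone {g : Equiv.Perm ℝ} (hg : g ∈ dyadicFone) : g ∈ Fone :=
  ⟨hg.1, hg.2.1⟩

/-! ### Bump elements -/

/-- The generator of Thompson's group `F` with slopes `1/2, 1, 2`, extended by the identity. -/
def thompsonGen : ℝ ≃o ℝ :=
  StrictMono.orderIsoOfRightInverse
    (fun t : ℝ => min t (max (t / 2) (max (t - 1 / 4) (2 * t - 1))))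
    (fun s t hst => by
      simp only [lt_min_iff, min_lt_iff, lt_max_iff, max_lt_iff]
      grind)
    (fun t : ℝ => max t (min (2 * t) (min (t + 1 / 4) ((t + 1) / 2))))
    (fun t => by grind)

lemma thompsonGen_apply (t : ℝ) :
    thompsonGen t = min t (max (t / 2) (max (t - 1 / 4) (2 * t - 1))) := rfl

lemma thompsonGen_symm_apply (t : ℝ) :
    thompsonGen.symm t = max t (min (2 * t) (min (t + 1 / 4) ((t + 1) / 2))) := rfl

lemma thompsonGen_of_nonpos {t : ℝ} (ht : t ≤ 0) : thompsonGen t = t := by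
  rw [thompsonGen_apply]
  grind

lemma thompsonGen_of_one_le {t : ℝ} (ht : 1 ≤ t) : thompsonGen t = t := by
  rw [thompsonGen_apply]
  grind

/-- A copy of `ψ` on `[p / 2 ^ k, (p + 1) / 2 ^ k]`, extended `1`-periodically. -/
def periodize (ψ : ℝ → ℝ) (p : ℤ) (k : ℕ) (x : ℝ) : ℝ :=
  ⌊x⌋ + (p + ψ (2 ^ k * Int.fract x - p)) / 2 ^ k

section periodize

variable {ψ : ℝ ≃o ℝ} {p : ℤ} {k : ℕ}

lemma periodize_offset_mem (h0 : ∀ t ≤ 0, ψ t = t) (h1 : ∀ t, 1 ≤ t → ψ t = t)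
    (hp : 0 ≤ p) (hpk : p + 1 ≤ 2 ^ k) (x : ℝ) :
    (p + ψ (2 ^ k * Int.fract x - p)) / 2 ^ k ∈ Ico (0 : ℝ) 1 := by
  have hp' : (0 : ℝ) ≤ p := by exact_mod_cast hp
  have hpk' : (p : ℝ) + 1 ≤ 2 ^ k := by exact_mod_cast hpk
  have h2 : (0 : ℝ) < 2 ^ k := by positivity
  constructor
  · have : ψ (-p) ≤ ψ (2 ^ k * Int.fract x - p) := ψ.monotone (by
      have := mul_nonneg h2.le (Int.fract_nonneg x)
      linarith)
    rw [h0 (-p) (by linarith)] at this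
    exact div_nonneg (by linarith) h2.le
  · have : ψ (2 ^ k * Int.fract x - p) < ψ (2 ^ k - p) := ψ.strictMono (by
      have := mul_lt_of_lt_one_right h2 (Int.fract_lt_one x)
      linarith)
    rw [h1 (2 ^ k - p) (by linarith)] at this
    rw [div_lt_one h2]
    linarith

lemma periodize_floor (h0 : ∀ t ≤ 0, ψ t = t) (h1 : ∀ t, 1 ≤ t → ψ t = t)
    (hp : 0 ≤ p) (hpk : p + 1 ≤ 2 ^ k) (x : ℝ) : ⌊periodize ψ p k x⌋ = ⌊x⌋ := by
  obtain ⟨h, h'⟩ := periodize_offset_mem h0 h1 hp hpk x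
  rw [Int.floor_eq_iff, periodize]
  constructor <;> linarith

lemma periodize_fract (h0 : ∀ t ≤ 0, ψ t = t) (h1 : ∀ t, 1 ≤ t → ψ t = t)
    (hp : 0 ≤ p) (hpk : p + 1 ≤ 2 ^ k) (x : ℝ) :
    Int.fract (periodize ψ p k x) = (p + ψ (2 ^ k * Int.fract x - p)) / 2 ^ k := by
  rw [Int.fract, periodize_floor h0 h1 hp hpk, periodize, add_sub_cancel_left]

lemma periodize_symm_periodize (h0 : ∀ t ≤ 0, ψ t = t) (h1 : ∀ t, 1 ≤ t → ψ t = t)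
    (hp : 0 ≤ p) (hpk : p + 1 ≤ 2 ^ k) (x : ℝ) :
    periodize ψ.symm p k (periodize ψ p k x) = x := by
  rw [periodize, periodize_floor h0 h1 hp hpk, periodize_fract h0 h1 hp hpk,
    mul_div_cancel₀ _ (by positivity), add_sub_cancel_left, OrderIso.symm_apply_apply,
    add_sub_cancel, mul_div_cancel_left₀ _ (by positivity), Int.floor_add_fract]

lemma periodize_strictMono (h0 : ∀ t ≤ 0, ψ t = t) (h1 : ∀ t, 1 ≤ t → ψ t = t)
    (hp : 0 ≤ p) (hpk : p + 1 ≤ 2 ^ k) : StrictMono (periodize ψ p k) := by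
  intro x y hxy
  rcases (Int.floor_mono hxy.le).lt_or_eq with h | h
  · refine lt_of_not_ge fun hle => h.not_ge ?_
    simpa only [periodize_floor h0 h1 hp hpk] using Int.floor_mono hle
  · have : ψ (2 ^ k * Int.fract x - p) < ψ (2 ^ k * Int.fract y - p) := ψ.strictMono (by
      rw [Int.fract, Int.fract, h]
      gcongr)
    rw [periodize, periodize, h]
    gcongr

lemma periodize_mem_dyadicSubring (hψ : ∀ t ∈ dyadicSubring, ψ t ∈ dyadicSubring) {x : ℝ}
    (hx : x ∈ dyadicSubring) : periodize ψ p k x ∈ dyadicSubring := by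
  have h2 : (2 : ℝ) ^ k ∈ dyadicSubring := two_zpow_mem_dyadicSubring k
  exact add_mem (intCast_mem _ _) (div_two_pow_mem_dyadicSubring (add_mem (intCast_mem _ _)
    (hψ _ (sub_mem (mul_mem h2 (sub_mem hx (intCast_mem _ _))) (intCast_mem _ _)))) k)

end periodize

lemma thompsonGen_mem_dyadicSubring {t : ℝ} (ht : t ∈ dyadicSubring) :
    thompsonGen t ∈ dyadicSubring := by
  have h2 : (2 : ℝ) ∈ dyadicSubring := by exact_mod_cast intCast_mem dyadicSubring 2
  have a1 := div_two_pow_mem_dyadicSubring ht 1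
  have a2 := sub_mem ht (inv_two_pow_mem_dyadicSubring 2)
  have a3 := sub_mem (mul_mem h2 ht) (one_mem dyadicSubring)
  norm_num at a1 a2
  rw [thompsonGen_apply]
  rcases min_choice t (max (t / 2) (max (t - 1 / 4) (2 * t - 1))) with h | h <;> rw [h]
  · exact ht
  rcases max_choice (t / 2) (max (t - 1 / 4) (2 * t - 1)) with h | h <;> rw [h]
  · exact a1
  rcases max_choice (t - 1 / 4) (2 * t - 1) with h | h <;> rw [h]
  · exact a2
  · exact a3

lemma thompsonGen_symm_mem_dyadicSubring {t : ℝ} (ht : t ∈ dyadicSubring) :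
    thompsonGen.symm t ∈ dyadicSubring := by
  have h2 : (2 : ℝ) ∈ dyadicSubring := by exact_mod_cast intCast_mem dyadicSubring 2
  have a1 := mul_mem h2 ht
  have a2 := add_mem ht (inv_two_pow_mem_dyadicSubring 2)
  have a3 := div_two_pow_mem_dyadicSubring (add_mem ht (one_mem dyadicSubring)) 1
  norm_num at a2 a3
  rw [thompsonGen_symm_apply]
  rcases max_choice t (min (2 * t) (min (t + 1 / 4) ((t + 1) / 2))) with h | h <;> rw [h]
  · exact ht
  rcases min_choice (2 * t) (min (t + 1 / 4) ((t + 1) / 2)) with h | h <;> rw [h]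
  · exact a1
  rcases min_choice (t + 1 / 4) ((t + 1) / 2) with h | h <;> rw [h]
  · exact a2
  · exact a3

lemma thompsonGen_symm_of_nonpos {t : ℝ} (ht : t ≤ 0) : thompsonGen.symm t = t := by
  rw [OrderIso.symm_apply_eq, thompsonGen_of_nonpos ht]

lemma thompsonGen_symm_of_one_le {t : ℝ} (ht : 1 ≤ t) : thompsonGen.symm t = t := by
  rw [OrderIso.symm_apply_eq, thompsonGen_of_one_le ht]

/-- The copy of the generator of Thompson's group `F` on `[p / 2 ^ k, (p + 1) / 2 ^ k]`, extended
`1`-periodically, as a permutation of `ℝ`. -/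
def bump (p : ℤ) (k : ℕ) (hp : 0 ≤ p) (hpk : p + 1 ≤ 2 ^ k) : Equiv.Perm ℝ where
  toFun := periodize thompsonGen p k
  invFun := periodize thompsonGen.symm p k
  left_inv := periodize_symm_periodize (fun _ => thompsonGen_of_nonpos)
    (fun _ => thompsonGen_of_one_le) hp hpk
  right_inv := periodize_symm_periodize (ψ := thompsonGen.symm)
    (fun _ => thompsonGen_symm_of_nonpos) (fun _ => thompsonGen_symm_of_one_le) hp hpk

/-- `thompsonGen` is affine with slope a power of two off its breakpoints. -/
lemma thompsonGen_eventually_affine {t : ℝ} (h0 : t ≠ 0) (h1 : t ≠ 1 / 2) (h2 : t ≠ 3 / 4)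
    (h3 : t ≠ 1) : ∃ (m : ℤ) (c : ℝ), ∀ᶠ s in nhds t, thompsonGen s = 2 ^ m * s + c := by
  rcases h0.lt_or_gt with h0 | h0
  · refine ⟨0, 0, ?_⟩
    filter_upwards [eventually_lt_nhds h0] with s hs
    simp [thompsonGen_of_nonpos hs.le]
  rcases h1.lt_or_gt with h1 | h1
  · refine ⟨-1, 0, ?_⟩
    filter_upwards [eventually_lt_nhds h1, eventually_gt_nhds h0] with s hs hs'
    rw [thompsonGen_apply, zpow_neg_one]
    grind
  rcases h2.lt_or_gt with h2 | h2
  · refine ⟨0, -1 / 4, ?_⟩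
    filter_upwards [eventually_lt_nhds h2, eventually_gt_nhds h1] with s hs hs'
    rw [thompsonGen_apply, zpow_zero]
    grind
  rcases h3.lt_or_gt with h3 | h3
  · refine ⟨1, -1, ?_⟩
    filter_upwards [eventually_lt_nhds h3, eventually_gt_nhds h2] with s hs hs'
    rw [thompsonGen_apply, zpow_one]
    grind
  · refine ⟨0, 0, ?_⟩
    filter_upwards [eventually_gt_nhds h3] with s hs
    simp [thompsonGen_of_one_le hs.le]

lemma periodize_add_one (ψ : ℝ → ℝ) (p : ℤ) (k : ℕ) (x : ℝ) :
    periodize ψ p k (x + 1) = periodize ψ p k x + 1 := by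
  simp only [periodize, Int.floor_add_one, Int.fract_add_one]
  push_cast
  ring

lemma finite_dyadic_grid (K : ℕ) (a b : ℝ) :
    ({x : ℝ | ∃ n : ℤ, x = n / 2 ^ K} ∩ Icc a b).Finite := by
  refine ((Set.finite_Icc ⌊a * 2 ^ K⌋ ⌈b * 2 ^ K⌉).image fun n : ℤ => (n : ℝ) / 2 ^ K).subset ?_
  rintro _ ⟨⟨n, rfl⟩, hna, hnb⟩
  refine ⟨n, ⟨?_, ?_⟩, rfl⟩
  · rw [le_div_iff₀ (by positivity)] at hna
    exact_mod_cast (Int.floor_le _).trans hna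
  · rw [div_le_iff₀ (by positivity)] at hnb
    exact_mod_cast hnb.trans (Int.le_ceil _)

lemma periodize_thompsonGen_tbarFun (p : ℤ) (k : ℕ) : TbarFun (periodize thompsonGen p k) := by
  refine ⟨periodize_add_one _ p k, {x : ℝ | ∃ n : ℤ, x = n / 2 ^ (k + 2)}, ?_,
    finite_dyadic_grid (k + 2), fun x hx => ?_⟩
  · rintro _ ⟨n, rfl⟩
    exact ⟨n, k + 2, rfl⟩
  have h2 : (0 : ℝ) < 2 ^ k := by positivity
  have hne : ∀ j : ℤ, 2 ^ k * (x - ⌊x⌋) - p ≠ (j : ℝ) / 4 := fun j hj => hx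
    ⟨4 * 2 ^ k * ⌊x⌋ + 4 * p + j, by
      rw [eq_div_iff (by positivity), pow_add]
      push_cast
      linarith⟩
  have hx0 : (⌊x⌋ : ℝ) < x := (Int.floor_le x).lt_of_ne fun h => hne (-4 * p) (by
    rw [← h, Int.floor_intCast]
    push_cast
    ring)
  obtain ⟨m, c, hmc⟩ := thompsonGen_eventually_affine (t := 2 ^ k * (x - ⌊x⌋) - p)
    (by simpa using hne 0) (by convert hne 2 using 1; norm_num) (by simpa using hne 3)
    (by simpa using hne 4)
  have hcont : Filter.Tendsto (fun y : ℝ => 2 ^ k * (y - ⌊x⌋) - p) (nhds x)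
      (nhds (2 ^ k * (x - ⌊x⌋) - p)) := Continuous.tendsto (by fun_prop) x
  have hev : ∀ᶠ y in nhds x, periodize thompsonGen p k y =
      2 ^ m * y + (⌊x⌋ + (p + 2 ^ m * (-2 ^ k * ⌊x⌋ - p) + c) / 2 ^ k) := by
    filter_upwards [eventually_gt_nhds hx0, eventually_lt_nhds (Int.lt_floor_add_one x),
      hcont.eventually hmc] with y hy1 hy2 hy3
    have hfl : ⌊y⌋ = ⌊x⌋ := Int.floor_eq_iff.2 ⟨hy1.le, hy2⟩
    rw [periodize, Int.fract, hfl, hy3]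
    field_simp
    ring
  obtain ⟨ε, hε, h⟩ := Metric.eventually_nhds_iff.1 hev
  exact ⟨m, _, ε, hε, fun y hy => h (by rwa [Real.dist_eq])⟩

section bump

variable {p : ℤ} {k : ℕ} (hp : 0 ≤ p) (hpk : p + 1 ≤ 2 ^ k)

lemma bump_mem_dyadicFone : bump p k hp hpk ∈ dyadicFone := by
  refine ⟨⟨periodize_strictMono (fun _ => thompsonGen_of_nonpos)
    (fun _ => thompsonGen_of_one_le) hp hpk, periodize_thompsonGen_tbarFun p k⟩, fun m => ?_,
    fun x => ⟨fun hx => ?_, fun hx => ?_⟩⟩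
  · change periodize _ p k m = m
    have hp' : (0 : ℝ) ≤ p := by exact_mod_cast hp
    simp [periodize, thompsonGen_of_nonpos (neg_nonpos.2 hp')]
  · rw [← (bump p k hp hpk).symm_apply_apply x]
    exact periodize_mem_dyadicSubring (ψ := thompsonGen.symm)
      (fun _ => thompsonGen_symm_mem_dyadicSubring) hx
  · exact periodize_mem_dyadicSubring (fun _ => thompsonGen_mem_dyadicSubring) hx

lemma bump_apply {M : ℤ} {t : ℝ} (ht : t ∈ Ico (0 : ℝ) 1) :
    bump p k hp hpk (M + (p + t) / 2 ^ k) = M + (p + thompsonGen t) / 2 ^ k := by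
  have hp' : (0 : ℝ) ≤ p := by exact_mod_cast hp
  have hpk' : (p : ℝ) + 1 ≤ 2 ^ k := by exact_mod_cast hpk
  have h2 : (0 : ℝ) < 2 ^ k := by positivity
  have hfl : ⌊(M : ℝ) + (p + t) / 2 ^ k⌋ = M := by
    have : (p + t) / 2 ^ k < 1 := by
      rw [div_lt_one h2]
      linarith [ht.2]
    have : 0 ≤ (p + t) / 2 ^ k := div_nonneg (by linarith [ht.1]) h2.le
    rw [Int.floor_eq_iff]
    constructor <;> linarith
  change periodize _ p k _ = _
  rw [periodize, Int.fract, hfl, add_sub_cancel_left, mul_div_cancel₀ _ h2.ne',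
    add_sub_cancel_left]

lemma bump_apply_of_notMem {M : ℤ} {x : ℝ} (hx : x ∈ Icc (M : ℝ) (M + 1))
    (hx' : x ∉ Ioo ((M : ℝ) + p / 2 ^ k) (M + (p + 1) / 2 ^ k)) : bump p k hp hpk x = x := by
  have h2 : (0 : ℝ) < 2 ^ k := by positivity
  rcases hx.2.lt_or_eq with hx1 | hx1
  · have hfl : ⌊x⌋ = M := Int.floor_eq_iff.2 ⟨hx.1, hx1⟩
    have hfix : thompsonGen (2 ^ k * (x - M) - p) = 2 ^ k * (x - M) - p := by
      rcases le_or_gt x (M + p / 2 ^ k) with h | h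
      · apply thompsonGen_of_nonpos
        rw [← sub_le_iff_le_add', le_div_iff₀ h2] at h
        linarith
      · apply thompsonGen_of_one_le
        have h := not_lt.1 fun h' => hx' ⟨h, h'⟩
        rw [← le_sub_iff_add_le', div_le_iff₀ h2] at h
        linarith
    change periodize _ p k _ = _
    rw [periodize, Int.fract, hfl, hfix]
    field_simp
    ring
  · have := (bump_mem_dyadicFone hp hpk).2.1 (M + 1)
    push_cast at this
    rw [hx1, this]

end bump

/-! ### The double commutator -/

/-- If `f` displaces `A` off itself inside `C`, and `u`, `v` are supported in `A` within `C`, then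
the double commutator `⁅⁅f, u⁆, v⁆` only sees `u` and `v` on `C`. -/
lemma double_commutator_apply {f u v : Equiv.Perm ℝ} {A C : Set ℝ} (hAC : A ⊆ C)
    (hfC : ∀ z, f z ∈ C ↔ z ∈ C) (huC : ∀ z, u z ∈ C ↔ z ∈ C) (hvC : ∀ z, v z ∈ C ↔ z ∈ C)
    (hfA : ∀ z ∈ A, f z ∉ A) (hu : ∀ z ∈ C, z ∉ A → u z = z) (hv : ∀ z ∈ C, z ∉ A → v z = z)
    {x : ℝ} (hx : x ∈ C) : ⁅⁅f, u⁆, v⁆ x = ⁅u⁻¹, v⁆ x := by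
  have inv_mem_C : ∀ {g : Equiv.Perm ℝ}, (∀ z, g z ∈ C ↔ z ∈ C) → ∀ {z}, z ∈ C → g⁻¹ z ∈ C :=
    fun {g} hg {z} hz => (hg _).1 (by rwa [Equiv.Perm.apply_inv_apply])
  have inv_fix : ∀ {g : Equiv.Perm ℝ} {z}, g z = z → g⁻¹ z = z := fun {g z} h => by
    rw [Equiv.Perm.inv_eq_iff_eq, h]
  have mem_A : ∀ {g : Equiv.Perm ℝ}, (∀ z, g z ∈ C ↔ z ∈ C) → (∀ z ∈ C, z ∉ A → g z = z) →
      ∀ {z}, z ∈ A → g z ∈ A := fun {g} hgC hg {z} hz => by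
    by_contra h
    have := g.injective (hg _ ((hgC z).2 (hAC hz)) h)
    exact h (by rwa [this])
  have inv_mem_A : ∀ {g : Equiv.Perm ℝ}, (∀ z, g z ∈ C ↔ z ∈ C) → (∀ z ∈ C, z ∉ A → g z = z) →
      ∀ {z}, z ∈ A → g⁻¹ z ∈ A := fun {g} hgC hg {z} hz => by
    by_contra h
    have := hg _ (inv_mem_C hgC (hAC hz)) h
    rw [Equiv.Perm.apply_inv_apply] at this
    exact h (this ▸ hz)
  obtain ⟨c, hc⟩ : ∃ c, c = f * u * f⁻¹ := ⟨_, rfl⟩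
  have hcA : ∀ z ∈ A, c z = z := fun z hz => by
    have h1 : f⁻¹ z ∉ A := fun h => hfA _ h (by rwa [Equiv.Perm.apply_inv_apply])
    rw [hc, Equiv.Perm.mul_apply, Equiv.Perm.mul_apply, hu _ (inv_mem_C hfC (hAC hz)) h1,
      Equiv.Perm.apply_inv_apply]
  have hcC : ∀ z, c z ∈ C ↔ z ∈ C := fun z => by
    rw [hc, Equiv.Perm.mul_apply, Equiv.Perm.mul_apply, hfC, huC, ← hfC,
      Equiv.Perm.apply_inv_apply]
  have hw : ⁅⁅f, u⁆, v⁆ x = c (u⁻¹ (v (u (c⁻¹ (v⁻¹ x))))) := by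
    rw [commutatorElement_def f u, ← hc, commutatorElement_def, mul_inv_rev, inv_inv]
    rfl
  have hg : ⁅u⁻¹, v⁆ x = u⁻¹ (v (u (v⁻¹ x))) := by
    rw [commutatorElement_def, inv_inv]
    rfl
  rw [hw, hg]
  by_cases hxA : x ∈ A
  · have h1 := inv_mem_A hvC hv hxA
    rw [inv_fix (hcA _ h1), hcA _ (inv_mem_A huC hu (mem_A hvC hv (mem_A huC hu h1)))]
  · have h1 : c⁻¹ x ∉ A := fun h => hxA (by
      have := hcA _ h
      rw [Equiv.Perm.apply_inv_apply] at this
      rwa [this])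
    have h2 := inv_mem_C hcC hx
    rw [inv_fix (hv x hx hxA), hu _ h2 h1, hv _ h2 h1, inv_fix (hu _ h2 h1),
      Equiv.Perm.apply_inv_apply, hu x hx hxA, hv x hx hxA, inv_fix (hu x hx hxA)]

lemma StrictMono.mem_Icc_iff_of_fixed {g : ℝ → ℝ} (hg : StrictMono g) {s t : ℝ} (hs : g s = s)
    (ht : g t = t) (z : ℝ) : g z ∈ Icc s t ↔ z ∈ Icc s t := by
  have h1 := hg.le_iff_le (a := s) (b := z)
  have h2 := hg.le_iff_le (a := z) (b := t)
  rw [hs] at h1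
  rw [ht] at h2
  exact and_congr h1 h2

/-- The bumps on an interval and on its right half do not commute, on any unit interval. -/
lemma bump_commutator_ne {p : ℤ} {k : ℕ} (hp : 0 ≤ p) (hpk : p + 1 ≤ 2 ^ k)
    (hp' : 0 ≤ 2 * p + 1) (hpk' : 2 * p + 1 + 1 ≤ 2 ^ (k + 1)) (M : ℤ) :
    ∃ x ∈ Icc (M : ℝ) (M + 1), ⁅(bump p k hp hpk)⁻¹, bump (2 * p + 1) (k + 1) hp' hpk'⁆ x ≠ x := by
  set u := bump p k hp hpk with hu
  set v := bump (2 * p + 1) (k + 1) hp' hpk' with hv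
  set y : ℝ := M + (p + 3 / 4) / 2 ^ k with hy
  have g1 : thompsonGen (3 / 4) = 1 / 2 := by rw [thompsonGen_apply]; norm_num
  have g2 : thompsonGen (1 / 2) = 1 / 4 := by rw [thompsonGen_apply]; norm_num
  have g3 : thompsonGen (5 / 8) = 3 / 8 := by rw [thompsonGen_apply]; norm_num
  have h2 : (0 : ℝ) < 2 ^ k := by positivity
  have hvy : v y = M + (p + 5 / 8) / 2 ^ k := by
    have := bump_apply hp' hpk' (M := M) (t := 1 / 2) (by norm_num)
    rw [g2] at this
    push_cast at this
    rw [hv, hy]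
    convert this using 2
    · rw [pow_succ]
      field_simp
      ring
    · rw [pow_succ]
      field_simp
      ring
  have huvy : u (v y) = M + (p + 3 / 8) / 2 ^ k := by
    rw [hvy, hu, bump_apply hp hpk (by norm_num), g3]
  have huy : u y = M + (p + 1 / 2) / 2 ^ k := by
    rw [hy, hu, bump_apply hp hpk (by norm_num), g1]
  have hvuy : v (u y) = M + (p + 1 / 2) / 2 ^ k := by
    have := bump_apply hp' hpk' (M := M) (t := 0) (by norm_num)
    rw [thompsonGen_of_nonpos le_rfl] at this
    push_cast at this
    rw [huy, hv]
    convert this using 2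
    · rw [pow_succ]
      field_simp
      ring
    · rw [pow_succ]
      field_simp
      ring
  have hpR : (0 : ℝ) ≤ p := by exact_mod_cast hp
  have hpkR : (p : ℝ) + 1 ≤ 2 ^ k := by exact_mod_cast hpk
  refine ⟨v y, ?_, fun h => ?_⟩
  · rw [hvy]
    have h3 : 0 ≤ ((p : ℝ) + 5 / 8) / 2 ^ k := by positivity
    have h4 : ((p : ℝ) + 5 / 8) / 2 ^ k ≤ 1 := by
      rw [div_le_one h2]
      linarith
    constructor <;> linarith
  · rw [commutatorElement_def, inv_inv] at h
    simp only [Equiv.Perm.mul_apply, Equiv.Perm.inv_apply_apply] at h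
    rw [Equiv.Perm.inv_eq_iff_eq, hvuy, huvy, add_right_inj, div_left_inj' h2.ne',
      add_right_inj] at h
    norm_num at h

/-- Near a point moved by `f`, small intervals are displaced off themselves, uniformly along all
integer translates close to a multiple of `l`. -/
lemma AlmostCommutes.exists_displaced {l : ℝ} {f : Equiv.Perm ℝ} (hf : AlmostCommutes l f) {x : ℝ}
    (hx : f x ≠ x) : ∃ r > 0, ∃ δ > 0, ∀ m k : ℤ, |(m : ℝ) - k * l| < δ →
      ∀ y, |y - x| < r → r ≤ |f (y + m) - (x + m)| := by
  have hd : 0 < |f x - x| := abs_pos.2 (sub_ne_zero.2 hx)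
  set d := |f x - x| with hd'
  obtain ⟨r, hr, h1⟩ := Metric.continuous_iff.1
    (Equiv.Perm.continuous_of_strictMono hf.strictMono) x (d / 4) (by positivity)
  obtain ⟨δ, hδ, h2⟩ := hf.almost_translation (d / 4) (by positivity)
  refine ⟨min r (d / 2), lt_min hr (by positivity), δ, hδ, fun m k hmk y hy => ?_⟩
  have e1 := h1 y (hy.trans_le (min_le_left _ _))
  have e2 := h2 m k hmk y
  rw [Real.dist_eq] at e1
  have e3 : d ≤ |f y - f x| + |f (y + m) - (f y + m)| + |f (y + m) - (x + m)| := by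
    rw [hd', abs_sub_comm (f y), abs_sub_comm (f (y + m))]
    refine le_trans (le_of_eq ?_) ((abs_add_three (f x - f y) (f y + m - f (y + m))
      (f (y + m) - (x + m))))
    congr 1
    ring
  refine (min_le_right _ _).trans ?_
  linarith

/-- Small dyadic intervals around a point. -/
lemma exists_dyadic_interval (t : ℝ) {r : ℝ} (hr : 0 < r) : ∃ (p : ℤ) (k : ℕ),
    t - r < p / 2 ^ k ∧ ((p : ℝ) + 1) / 2 ^ k < t + r := by
  obtain ⟨k, hk⟩ := exists_pow_lt_of_lt_one hr (by norm_num : (1 / 2 : ℝ) < 1)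
  have h2 : (0 : ℝ) < 2 ^ k := by positivity
  rw [one_div, inv_pow, inv_lt_iff_one_lt_mul₀ h2] at hk
  have h3 := Int.floor_le (t * 2 ^ k)
  have h4 := Int.lt_floor_add_one (t * 2 ^ k)
  refine ⟨⌊t * 2 ^ k⌋, k, ?_, ?_⟩
  · rw [lt_div_iff₀ h2]
    linarith
  · rw [div_lt_iff₀ h2]
    linarith

/-- Proposition 2.11 of the paper. If a nontrivial `f ∈ G_λ` has
support in `⋃_{n ∈ ℤ} (n + I)` for an open interval `I = (a, b)` with closure in
`(0,1)`, then the normal closure of `f` in `G_λ` contains a nontrivial `(I,N)`-stable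
element `h` for some `N`: the support of `h` lies in `⋃_{n ∈ ℤ} (n + I)`, and there is a
nontrivial element `g` of `F₁ = ν(F)` such that every interval of length greater than
`N` contains an interval `[m, m+1]`, `m ∈ ℤ`, on which `h` agrees with `ν(g)`. -/
theorem stmt_11 (l : ℝ) (hl : 1 < l) (hirr : Irrational l)
    (a b : ℝ) (ha : 0 < a) (hab : a < b) (hb : b < 1)
    (f : ↥(Glambda l)) (hf : f ≠ 1)
    (hsupp : {x : ℝ | (f : Equiv.Perm ℝ) x ≠ x} ⊆
      ⋃ n : ℤ, Set.Ioo ((n : ℝ) + a) ((n : ℝ) + b)) :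
    ∃ h ∈ Subgroup.normalClosure ({f} : Set ↥(Glambda l)), h ≠ 1 ∧
      ∃ N : ℕ,
        {x : ℝ | (h : Equiv.Perm ℝ) x ≠ x} ⊆
          (⋃ n : ℤ, Set.Ioo ((n : ℝ) + a) ((n : ℝ) + b)) ∧
        ∃ g ∈ Fone, g ≠ 1 ∧
          ∀ c d : ℝ, (N : ℝ) < d - c →
            ∃ m : ℤ, Set.Icc (m : ℝ) (m + 1) ⊆ Set.Ioo c d ∧
              ∀ x ∈ Set.Icc (m : ℝ) (m + 1), (h : Equiv.Perm ℝ) x = g x := by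
  have hl0 : 0 < l := one_pos.trans hl
  have hfac := AlmostCommutes.of_mem_Glambda hl0 f.2
  set U : Set ℝ := ⋃ n : ℤ, Set.Ioo ((n : ℝ) + a) ((n : ℝ) + b) with hU
  have hfU : ∀ x, x ∉ U → (f : Equiv.Perm ℝ) x = x := fun x hx => by
    by_contra h
    exact hx (hsupp h)
  have hint : ∀ M : ℤ, (M : ℝ) ∉ U := fun M hM => by
    obtain ⟨n, h1, h2⟩ := mem_iUnion.1 hM
    have h3 : n < M := by exact_mod_cast (by linarith : (n : ℝ) < M)
    have h4 : M < n + 1 := by exact_mod_cast (by linarith : (M : ℝ) < n + 1)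
    omega
  obtain ⟨x₀, hx₀⟩ : ∃ x, (f : Equiv.Perm ℝ) x ≠ x := by
    by_contra! h
    exact hf (Subtype.ext (Equiv.ext h))
  obtain ⟨n₀, hn₀⟩ := mem_iUnion.1 (hsupp hx₀)
  obtain ⟨r, hr, δ, hδ, hdisp⟩ := hfac.exists_displaced hx₀
  have hρ : 0 < min r (min (x₀ - n₀ - a) (b - (x₀ - n₀))) := by
    refine lt_min hr (lt_min ?_ ?_) <;> linarith [hn₀.1, hn₀.2]
  obtain ⟨p, k, hq₁, hq₂⟩ := exists_dyadic_interval (x₀ - n₀) hρ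
  have hρ₁ : min r (min (x₀ - n₀ - a) (b - (x₀ - n₀))) ≤ r := min_le_left _ _
  have hρ₂ : min r (min (x₀ - n₀ - a) (b - (x₀ - n₀))) ≤ x₀ - n₀ - a :=
    (min_le_right _ _).trans (min_le_left _ _)
  have hρ₃ : min r (min (x₀ - n₀ - a) (b - (x₀ - n₀))) ≤ b - (x₀ - n₀) :=
    (min_le_right _ _).trans (min_le_right _ _)
  have h2 : (0 : ℝ) < 2 ^ k := by positivity
  have hqa : a < p / 2 ^ k := by linarith
  have hqb : ((p : ℝ) + 1) / 2 ^ k < b := by linarith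
  have hp : 0 ≤ p := by
    have : (0 : ℝ) < p := by
      rw [lt_div_iff₀ h2] at hqa
      exact (mul_pos ha h2).trans hqa
    exact_mod_cast this.le
  have hpk : p + 1 ≤ 2 ^ k := by
    have : (p : ℝ) + 1 ≤ 2 ^ k := by
      rw [← div_le_one h2]
      linarith
    exact_mod_cast this
  have hp' : 0 ≤ 2 * p + 1 := by omega
  have hpk' : 2 * p + 1 + 1 ≤ 2 ^ (k + 1) := by
    rw [pow_succ]
    omega
  set u := bump p k hp hpk with hu
  set v := bump (2 * p + 1) (k + 1) hp' hpk' with hv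
  have hum : u ∈ dyadicFone := bump_mem_dyadicFone hp hpk
  have hvm : v ∈ dyadicFone := bump_mem_dyadicFone hp' hpk'
  let A : ℤ → Set ℝ := fun M => Ioo ((M : ℝ) + p / 2 ^ k) (M + (p + 1) / 2 ^ k)
  have huA : ∀ (M : ℤ), ∀ z ∈ Icc (M : ℝ) (M + 1), z ∉ A M → u z = z :=
    fun M z hz hzA => bump_apply_of_notMem hp hpk hz hzA
  have hvA : ∀ (M : ℤ), ∀ z ∈ Icc (M : ℝ) (M + 1), z ∉ A M → v z = z := by
    refine fun M z hz hzA => bump_apply_of_notMem hp' hpk' hz fun h => hzA ⟨?_, ?_⟩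
    · refine lt_of_le_of_lt ?_ h.1
      push_cast
      rw [pow_succ, add_le_add_iff_left, div_le_div_iff₀ h2 (by positivity)]
      nlinarith
    · refine h.2.trans_eq ?_
      push_cast
      rw [pow_succ]
      field_simp
      ring
  have hAC : ∀ M : ℤ, A M ⊆ Icc (M : ℝ) (M + 1) :=
    fun M z hz => ⟨by linarith [hz.1], by linarith [hz.2]⟩
  have hAU : ∀ M : ℤ, A M ⊆ U :=
    fun M z hz => mem_iUnion.2 ⟨M, by linarith [hz.1], by linarith [hz.2]⟩
  have fixU : ∀ {w : Equiv.Perm ℝ}, (∀ (M : ℤ), ∀ z ∈ Icc (M : ℝ) (M + 1), z ∉ A M → w z = z) →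
      w ∈ fixingSubgroup (Equiv.Perm ℝ) Uᶜ := fun {w} hw => by
    rw [mem_fixingSubgroup_iff]
    exact fun z hz => hw ⌊z⌋ z ⟨Int.floor_le z, (Int.lt_floor_add_one z).le⟩
      fun h => hz (hAU _ h)
  have huU := fixU huA
  have hvU := fixU hvA
  have hfU' : (f : Equiv.Perm ℝ) ∈ fixingSubgroup (Equiv.Perm ℝ) Uᶜ := by
    rw [mem_fixingSubgroup_iff]
    exact hfU
  let u' : Glambda l := ⟨u, Subgroup.subset_closure (Or.inl hum.1)⟩
  let v' : Glambda l := ⟨v, Subgroup.subset_closure (Or.inl hvm.1)⟩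
  have hmem : ⁅⁅f, u'⁆, v'⁆ ∈ Subgroup.normalClosure ({f} : Set (Glambda l)) := by
    have comm_mem : ∀ {s t : Glambda l}, s ∈ Subgroup.normalClosure ({f} : Set (Glambda l)) →
        ⁅s, t⁆ ∈ Subgroup.normalClosure ({f} : Set (Glambda l)) := fun {s t} hs => by
      rw [commutatorElement_def, mul_assoc, mul_assoc, ← mul_assoc t]
      exact mul_mem hs (Subgroup.normalClosure_normal.conj_mem _ (inv_mem hs) t)
    exact comm_mem (comm_mem (Subgroup.subset_normalClosure rfl))
  have hcoe : ((⁅⁅f, u'⁆, v'⁆ : Glambda l) : Equiv.Perm ℝ) = ⁅⁅(f : Equiv.Perm ℝ), u⁆, v⁆ := rfl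
  have hne := bump_commutator_ne hp hpk hp' hpk'
  obtain ⟨B, hB⟩ := exists_int_near_multiple hl0 hδ
  have hagree : ∀ c d : ℝ, ((2 * B + 2 : ℕ) : ℝ) < d - c →
      ∃ m : ℤ, Set.Icc (m : ℝ) (m + 1) ⊆ Set.Ioo c d ∧
        ∀ x ∈ Set.Icc (m : ℝ) (m + 1), ⁅⁅(f : Equiv.Perm ℝ), u⁆, v⁆ x = ⁅u⁻¹, v⁆ x := by
    intro c d hcd
    obtain ⟨m, j, hm, hmj⟩ := hB (⌊c⌋ + 1 + B - n₀)
    rw [abs_le] at hm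
    have hM₁ : (⌊c⌋ : ℝ) + 1 ≤ (n₀ + m : ℤ) := by exact_mod_cast (by omega : ⌊c⌋ + 1 ≤ n₀ + m)
    have hM₂ : ((n₀ + m : ℤ) : ℝ) ≤ ⌊c⌋ + 1 + 2 * B := by
      exact_mod_cast (by omega : n₀ + m ≤ ⌊c⌋ + 1 + 2 * B)
    have hc₁ := Int.floor_le c
    have hc₂ := Int.lt_floor_add_one c
    push_cast at hcd
    refine ⟨n₀ + m, fun z hz => ⟨by linarith [hz.1], by linarith [hz.2]⟩, fun x hx => ?_⟩
    have hpres : ∀ {w : Equiv.Perm ℝ}, StrictMono w → (∀ M : ℤ, w M = M) → ∀ z,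
        w z ∈ Icc ((n₀ + m : ℤ) : ℝ) ((n₀ + m : ℤ) + 1) ↔
          z ∈ Icc ((n₀ + m : ℤ) : ℝ) ((n₀ + m : ℤ) + 1) :=
      fun hw hfix => hw.mem_Icc_iff_of_fixed (hfix _) (by exact_mod_cast hfix (n₀ + m + 1))
    refine double_commutator_apply (hAC (n₀ + m))
      (hpres hfac.strictMono fun M => hfU _ (hint M)) (hpres hum.1.1 hum.2.1)
      (hpres hvm.1.1 hvm.2.1) (fun z hz hfz => ?_) (huA _) (hvA _) hx
    obtain ⟨hz₁, hz₂⟩ := hz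
    obtain ⟨hf₁, hf₂⟩ := hfz
    push_cast at hz₁ hz₂ hf₁ hf₂
    have := hdisp m j hmj (z - m) (by rw [abs_lt]; constructor <;> linarith)
    rw [sub_add_cancel] at this
    refine this.not_gt ?_
    rw [abs_lt]
    constructor <;> linarith
  refine ⟨⁅⁅f, u'⁆, v'⁆, hmem, fun h => ?_, 2 * B + 2, ?_, ⁅u⁻¹, v⁆, ?_, fun h => ?_, hagree⟩
  · obtain ⟨M, -, hM⟩ := hagree 0 (2 * B + 3) (by push_cast; linarith)
    obtain ⟨x, hx, hgx⟩ := hne M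
    apply hgx
    rw [← hM x hx, ← hcoe, h]
    rfl
  · intro x hx
    by_contra hxU
    have hfix : ⁅⁅(f : Equiv.Perm ℝ), u⁆, v⁆ ∈ fixingSubgroup (Equiv.Perm ℝ) Uᶜ := by
      simp only [commutatorElement_def]
      exact mul_mem (mul_mem (mul_mem (mul_mem (mul_mem (mul_mem hfU' huU) (inv_mem hfU'))
        (inv_mem huU)) hvU) (inv_mem (mul_mem (mul_mem (mul_mem hfU' huU) (inv_mem hfU'))
        (inv_mem huU)))) (inv_mem hvU)
    exact hx ((mem_fixingSubgroup_iff _).1 hfix x hxU)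
  · refine dyadicFone_subset_Fone ?_
    rw [commutatorElement_def]
    exact mul_mem (mul_mem (mul_mem (inv_mem hum) hvm) (inv_mem (inv_mem hum))) (inv_mem hvm)
  · obtain ⟨x, -, hgx⟩ := hne 0
    exact hgx (by rw [h]; rfl)
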